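/- Let S be a finite semilattice possessing a multiplicative identity element 1 (the maximal element), and let d be the coefficient function of the unique diagonal of ℓ¹(S). Then for every p ∈ S with p < 1, the integer d(p,p) is even; in particular d(p,p) ≥ 2. -/

import Mathlib

open scoped TensorProduct ComplexOrder

/-- `D ∈ A ⊗ A` is a *diagonal* for the (possibly non-unital) algebra `A`:
`a·m(D) = a = m(D)·a` and `a·D = D·a` for every `a ∈ A`. -/
def IsDiagonal {A : Type*} [NonUnitalSemiring A] [Module ℂ A]
    [SMulCommClass ℂ A A] [IsScalarTower ℂ A A] (D : A ⊗[ℂ] A) : Prop :=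
  (∀ a : A, a * LinearMap.mul' ℂ A D = a ∧ LinearMap.mul' ℂ A D * a = a) ∧
  (∀ a : A, TensorProduct.map (LinearMap.mulLeft ℂ a) LinearMap.id D =
            TensorProduct.map LinearMap.id (LinearMap.mulRight ℂ a) D)

/-- Two characters see the two module actions on a diagonal as the same scalar multiplication. -/
lemma IsDiagonal.map_mul_eq {A : Type*} [NonUnitalSemiring A] [Module ℂ A]
    [SMulCommClass ℂ A A] [IsScalarTower ℂ A A] {D : A ⊗[ℂ] A} (hD : IsDiagonal D)
    (φ ψ : A →ₙₐ[ℂ] ℂ) (a : A) :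
    φ a * LinearMap.mul' ℂ ℂ (TensorProduct.map (φ : A →ₗ[ℂ] ℂ) (ψ : A →ₗ[ℂ] ℂ) D) =
      ψ a * LinearMap.mul' ℂ ℂ (TensorProduct.map (φ : A →ₗ[ℂ] ℂ) (ψ : A →ₗ[ℂ] ℂ) D) := by
  have hleft : ∀ E : A ⊗[ℂ] A,
      LinearMap.mul' ℂ ℂ (TensorProduct.map (φ : A →ₗ[ℂ] ℂ) (ψ : A →ₗ[ℂ] ℂ)
        (TensorProduct.map (LinearMap.mulLeft ℂ a) LinearMap.id E)) =
      φ a * LinearMap.mul' ℂ ℂ (TensorProduct.map (φ : A →ₗ[ℂ] ℂ) (ψ : A →ₗ[ℂ] ℂ) E) := by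
    intro E
    induction E using TensorProduct.induction_on with
    | zero => simp
    | tmul x y => simp [mul_assoc]
    | add x y hx hy => simp only [map_add, hx, hy, mul_add]
  have hright : ∀ E : A ⊗[ℂ] A,
      LinearMap.mul' ℂ ℂ (TensorProduct.map (φ : A →ₗ[ℂ] ℂ) (ψ : A →ₗ[ℂ] ℂ)
        (TensorProduct.map LinearMap.id (LinearMap.mulRight ℂ a) E)) =
      ψ a * LinearMap.mul' ℂ ℂ (TensorProduct.map (φ : A →ₗ[ℂ] ℂ) (ψ : A →ₗ[ℂ] ℂ) E) := by
    intro E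
    induction E using TensorProduct.induction_on with
    | zero => simp
    | tmul x y => simp; ring
    | add x y hx hy => simp only [map_add, hx, hy, mul_add]
  rw [← hleft, ← hright, hD.2 a]

/-- A nonzero character takes the value `1` on a diagonal. -/
lemma IsDiagonal.map_self_eq_one {A : Type*} [NonUnitalSemiring A] [Module ℂ A]
    [SMulCommClass ℂ A A] [IsScalarTower ℂ A A] {D : A ⊗[ℂ] A} (hD : IsDiagonal D)
    (φ : A →ₙₐ[ℂ] ℂ) {a : A} (ha : φ a ≠ 0) :
    LinearMap.mul' ℂ ℂ (TensorProduct.map (φ : A →ₗ[ℂ] ℂ) (φ : A →ₗ[ℂ] ℂ) D) = 1 := by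
  have hmul : ∀ E : A ⊗[ℂ] A,
      LinearMap.mul' ℂ ℂ (TensorProduct.map (φ : A →ₗ[ℂ] ℂ) (φ : A →ₗ[ℂ] ℂ) E) =
      φ (LinearMap.mul' ℂ A E) := by
    intro E
    induction E using TensorProduct.induction_on with
    | zero => simp
    | tmul x y => simp
    | add x y hx hy => simp only [map_add, hx, hy]
  have h := congrArg φ (hD.1 a).1
  rw [map_mul] at h
  rw [hmul]
  exact mul_left_cancel₀ ha (by rw [h, mul_one])

/-- The indicator of the principal filter `{s | r ≤ s}` of a semilattice, as a character. -/
noncomputable def filterCharacter {S : Type*} [CommSemigroup S] (hidem : ∀ s : S, s * s = s)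
    (r : S) : S →ₙ* ℂ := by
  classical
  exact
  { toFun := fun s => if r * s = r then 1 else 0
    map_mul' := by
      intro s t
      have key : r * (s * t) = r ↔ r * s = r ∧ r * t = r := by
        constructor
        · intro h
          constructor
          · rw [← h, mul_assoc, mul_right_comm s t s, hidem]
          · rw [← h, mul_assoc, mul_assoc s t t, hidem]
        · rintro ⟨hs, ht⟩
          rw [← mul_assoc, hs, ht]
      by_cases hs : r * s = r <;> by_cases ht : r * t = r <;> simp [key, hs, ht] }

lemma filterCharacter_apply {S : Type*} [CommSemigroup S] [DecidableEq S]
    (hidem : ∀ s : S, s * s = s) (r s : S) :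
    filterCharacter hidem r s = if r * s = r then 1 else 0 := by
  simp only [filterCharacter, MulHom.coe_mk]
  congr

/-- The coefficient matrix of a diagonal is inverted by the zeta matrix of the semilattice. -/
lemma IsDiagonal.zeta_mul_coeff_mul_zeta {S : Type*} [Fintype S] [DecidableEq S]
    [CommSemigroup S] (hidem : ∀ s : S, s * s = s) (d : S × S → ℂ)
    (hD : IsDiagonal (∑ q : S × S, d q •
      (MonoidAlgebra.single q.1 (1 : ℂ) ⊗ₜ[ℂ] MonoidAlgebra.single q.2 (1 : ℂ)))) :
    (Matrix.of fun r s : S => if r * s = r then (1 : ℂ) else 0) *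
      (Matrix.of fun s t : S => d (s, t)) *
      (Matrix.of fun r s : S => if r * s = r then (1 : ℂ) else 0).transpose = 1 := by
  let χ : S → MonoidAlgebra ℂ S →ₙₐ[ℂ] ℂ := fun r =>
    MonoidAlgebra.liftMagma ℂ (filterCharacter hidem r)
  have hχ : ∀ r s : S, χ r (MonoidAlgebra.single s 1) = if r * s = r then (1 : ℂ) else 0 := by
    intro r s
    simp [χ, MonoidAlgebra.liftMagma, filterCharacter_apply]
  ext r t
  have hentry : ((Matrix.of fun r s : S => if r * s = r then (1 : ℂ) else 0) *
      (Matrix.of fun s t : S => d (s, t)) *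
      (Matrix.of fun r s : S => if r * s = r then (1 : ℂ) else 0).transpose) r t =
      LinearMap.mul' ℂ ℂ (TensorProduct.map (χ r : MonoidAlgebra ℂ S →ₗ[ℂ] ℂ)
        (χ t : MonoidAlgebra ℂ S →ₗ[ℂ] ℂ) (∑ q : S × S, d q •
        (MonoidAlgebra.single q.1 (1 : ℂ) ⊗ₜ[ℂ] MonoidAlgebra.single q.2 (1 : ℂ)))) := by
    simp only [map_sum, map_smul, TensorProduct.map_tmul, LinearMap.mul'_apply,
      LinearMap.coe_coe, hχ, Fintype.sum_prod_type,
      Matrix.mul_apply, Matrix.of_apply, Matrix.transpose_apply, Finset.sum_mul, smul_eq_mul]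
    rw [Finset.sum_comm]
    refine Finset.sum_congr rfl fun x _ => Finset.sum_congr rfl fun y _ => ?_
    ring
  rw [hentry]
  by_cases hrt : r = t
  · subst hrt
    rw [Matrix.one_apply_eq]
    refine hD.map_self_eq_one (χ r) (a := MonoidAlgebra.single r 1) ?_
    simp [hχ, hidem]
  · rw [Matrix.one_apply_ne hrt]
    have hr := hD.map_mul_eq (χ r) (χ t) (MonoidAlgebra.single r 1)
    have ht := hD.map_mul_eq (χ r) (χ t) (MonoidAlgebra.single t 1)
    rw [hχ, hχ, if_pos (hidem r), one_mul] at hr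
    rw [hχ, hχ, if_pos (hidem t), one_mul] at ht
    by_cases htr : t * r = t
    · have hne : r * t ≠ r := fun h => hrt (by rw [← h, mul_comm, htr])
      rw [if_neg hne, zero_mul] at ht
      exact ht.symm
    · rw [if_neg htr, zero_mul] at hr
      exact hr

/-- The zeta matrix of a finite partial order has an integral left inverse. -/
lemma exists_int_matrix_mul_zeta_eq_one (S : Type*) [Fintype S] [DecidableEq S] [PartialOrder S]
    [DecidableLE S] :
    ∃ M : Matrix S S ℤ, M * (Matrix.of fun r s : S => if r ≤ s then (1 : ℤ) else 0) = 1 := by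
  classical
  let _ : LocallyFiniteOrder S := Fintype.toLocallyFiniteOrder
  refine ⟨Matrix.of fun r s => IncidenceAlgebra.mu ℤ r s, ?_⟩
  ext r t
  have h := congrArg (fun f : IncidenceAlgebra ℤ S => f r t)
    (IncidenceAlgebra.mu_mul_zeta (𝕜 := ℤ) (α := S))
  simp only [IncidenceAlgebra.mul_apply, IncidenceAlgebra.one_apply,
    IncidenceAlgebra.zeta_apply] at h
  rw [Matrix.one_apply, ← h, Matrix.mul_apply]
  simp only [Matrix.of_apply]
  symm
  refine Finset.sum_subset_zero_on_sdiff (Finset.subset_univ _) ?_ fun x _ => rfl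
  intro x hx
  simp only [Finset.mem_sdiff, Finset.mem_univ, true_and, Finset.mem_Icc, not_and] at hx
  by_cases hrx : r ≤ x
  · simp [hx hrx]
  · simp [IncidenceAlgebra.apply_eq_zero_of_not_le hrx]

/-- The natural partial order `s ≤ t ↔ s * t = s` of a semilattice. -/
abbrev semilatticePartialOrder {S : Type*} [CommSemigroup S] (hidem : ∀ s : S, s * s = s) :
    PartialOrder S where
  le s t := s * t = s
  le_refl := hidem
  le_trans a b c hab hbc := by
    rw [← hab, mul_assoc, hbc]
  le_antisymm a b hab hba := by
    rw [← hab, mul_comm, hba]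

/-- A vector of integers with zero sum has even sum of squares. -/
lemma even_sum_sq_of_sum_eq_zero {ι : Type*} (s : Finset ι) (f : ι → ℤ)
    (h : ∑ i ∈ s, f i = 0) : Even (∑ i ∈ s, f i * f i) := by
  have hsub : ∑ i ∈ s, f i * f i = ∑ i ∈ s, f i * (f i - 1) := by
    simp [mul_sub, Finset.sum_sub_distrib, h]
  rw [hsub]
  exact Finset.even_sum _ fun i _ => Int.even_mul_pred_self (f i)

/-- **Diagonal entries of a unital finite semilattice.**
Let `S` be a finite semilattice possessing a multiplicative identity `e`
(the maximal element), and let `d` be the coefficient function of the unique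
diagonal of `ℓ¹(S)`.  Then for every `p < e` the integer `d(p,p)` is even;
in particular `d(p,p) ≥ 2`. -/
theorem diagonal_entry_even_of_unital (S : Type) [Fintype S] [Nonempty S]
    [CommSemigroup S] (hidem : ∀ s : S, s * s = s)
    (e : S) (he : ∀ s : S, e * s = s)
    (d : S × S → ℂ)
    (D : MonoidAlgebra ℂ S ⊗[ℂ] MonoidAlgebra ℂ S)
    (hD : IsDiagonal D)
    (hDd : D = ∑ q : S × S,
        d q • (MonoidAlgebra.single q.1 (1 : ℂ) ⊗ₜ[ℂ] MonoidAlgebra.single q.2 (1 : ℂ))) :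
    ∀ p : S, p ≠ e → (∃ k : ℤ, d (p, p) = 2 * (k : ℂ)) ∧ (2 : ℂ) ≤ d (p, p) := by
  classical
  intro p hp
  let _ : PartialOrder S := semilatticePartialOrder hidem
  obtain ⟨M, hM⟩ := exists_int_matrix_mul_zeta_eq_one S
  set Z : Matrix S S ℤ := Matrix.of fun r s : S => if r ≤ s then (1 : ℤ) else 0 with hZ
  subst hDd
  have hcoeff := hD.zeta_mul_coeff_mul_zeta hidem d
  have hZC : (Matrix.of fun r s : S => if r * s = r then (1 : ℂ) else 0) =
      Z.map (Int.castRingHom ℂ) := by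
    ext r s
    have hle : r ≤ s ↔ r * s = r := Iff.rfl
    by_cases h : r * s = r <;> simp [hZ, hle, h]
  rw [hZC] at hcoeff
  have hMC : M.map (Int.castRingHom ℂ) * Z.map (Int.castRingHom ℂ) = 1 := by
    rw [← Matrix.map_mul, hM]
    simp
  have hMCt : (Z.map (Int.castRingHom ℂ)).transpose * (M.map (Int.castRingHom ℂ)).transpose
      = 1 := by
    rw [← Matrix.transpose_mul, hMC, Matrix.transpose_one]
  have hd : (Matrix.of fun s t : S => d (s, t)) =
      M.map (Int.castRingHom ℂ) * (M.map (Int.castRingHom ℂ)).transpose := by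
    calc (Matrix.of fun s t : S => d (s, t))
        = (M.map (Int.castRingHom ℂ) * Z.map (Int.castRingHom ℂ)) *
            (Matrix.of fun s t : S => d (s, t)) *
            ((Z.map (Int.castRingHom ℂ)).transpose *
              (M.map (Int.castRingHom ℂ)).transpose) := by
          rw [hMC, hMCt, one_mul, mul_one]
      _ = M.map (Int.castRingHom ℂ) * (Z.map (Int.castRingHom ℂ) *
            (Matrix.of fun s t : S => d (s, t)) * (Z.map (Int.castRingHom ℂ)).transpose) *
            (M.map (Int.castRingHom ℂ)).transpose := by
          simp only [mul_assoc]
      _ = _ := by rw [hcoeff, mul_one]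
  have hdp : d (p, p) = ((∑ r, M p r * M p r : ℤ) : ℂ) := by
    have h := congrFun (congrFun hd p) p
    simpa [Matrix.mul_apply] using h
  have hsum : ∑ r, M p r = 0 := by
    have h := congrFun (congrFun hM p) e
    have hle : ∀ r : S, r ≤ e := fun r => (mul_comm r e).trans (he r)
    simpa [Matrix.mul_apply, hZ, hle, Matrix.one_apply_ne hp] using h
  have hpos : 0 < ∑ r, M p r * M p r := by
    refine lt_of_le_of_ne (Finset.sum_nonneg fun r _ => mul_self_nonneg _) fun h0 => ?_
    have hrow : ∀ r, M p r = 0 := fun r => mul_self_eq_zero.mp <|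
      (Finset.sum_eq_zero_iff_of_nonneg fun r _ => mul_self_nonneg (M p r)).mp h0.symm r
        (Finset.mem_univ r)
    have h := congrFun (congrFun hM p) p
    simp [Matrix.mul_apply, hrow] at h
  obtain ⟨k, hk⟩ := even_sum_sq_of_sum_eq_zero Finset.univ (M p) hsum
  rw [hdp]
  refine ⟨⟨k, by rw [hk]; push_cast; ring⟩, ?_⟩
  have htwo : (2 : ℤ) ≤ ∑ r, M p r * M p r := by omega
  exact_mod_cast htwo
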